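/- Let K be a hexameral domain and let σ₀ : [t₀,t₁] → ℝ² be a C¹ regular parametrization of an arc of the boundary of K, traversed counterclockwise. For each t, let σ_j(t), j ∈ ℤ/6ℤ, denote the midpoints, listed in counterclockwise cyclic order starting from σ₀(t), of the unique balanced hexagon of K having σ₀(t) as a midpoint. Then σ₂ and σ₄ are C¹ regular parametrizations of arcs of the boundary of K, oriented in the same (counterclockwise) direction as σ₀. -/

import Mathlib

open MeasureTheory

noncomputable section

/-- The wedge (cross) product of two planar vectors. -/
def wedge (v w : ℝ × ℝ) : ℝ := v.1 * w.2 - v.2 * w.1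

/-- A centrally symmetric convex domain in the plane. -/
def IsCSCD (K : Set (ℝ × ℝ)) : Prop :=
  Convex ℝ K ∧ IsCompact K ∧ (interior K).Nonempty ∧ K = -K

/-- `L` is a supporting line of `K` at the boundary point `p`. -/
def IsSupportingLineAt (K : Set (ℝ × ℝ)) (p : ℝ × ℝ) (L : Set (ℝ × ℝ)) : Prop :=
  ∃ f : (ℝ × ℝ) →ₗ[ℝ] ℝ, f ≠ 0 ∧ L = {x | f x = f p} ∧ ∀ x ∈ K, f x ≤ f p

/-- `K` has no corners. -/
def NoCorners (K : Set (ℝ × ℝ)) : Prop :=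
  ∀ p ∈ frontier K, ∃! L : Set (ℝ × ℝ), IsSupportingLineAt K p L

/-- `w : ZMod 6 → ℝ × ℝ` lists, in counterclockwise cyclic order, the vertices of
a balanced hexagon of `K`. -/
def IsBalancedHexagon (K : Set (ℝ × ℝ)) (w : ZMod 6 → ℝ × ℝ) : Prop :=
  (∀ j, w (j + 3) = -w j) ∧
  (∀ j, 0 ≤ wedge (w (j + 1) - w j) (w (j + 2) - w (j + 1))) ∧
  K ⊆ convexHull ℝ (Set.range w) ∧
  (∀ j, midpoint ℝ (w j) (w (j + 1)) ∈ frontier K)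

/-- A hexameral domain: a centrally symmetric convex domain centered at the origin,
without corners, each of whose boundary points is a midpoint of a balanced hexagon,
all these balanced hexagons having the same area. -/
def IsHexameral (K : Set (ℝ × ℝ)) : Prop :=
  IsCSCD K ∧ NoCorners K ∧
  (∀ p ∈ frontier K, ∃ w : ZMod 6 → ℝ × ℝ, IsBalancedHexagon K w ∧
    ∃ j, midpoint ℝ (w j) (w (j + 1)) = p) ∧
  (∃ A : ℝ, ∀ w : ZMod 6 → ℝ × ℝ, IsBalancedHexagon K w →
    (volume (convexHull ℝ (Set.range w))).toReal = A)

open Set Filter Topology Asymptotics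

section Volume

lemma volume_wedge_eq_zero {a : ℝ × ℝ} (ha : a ≠ 0) :
    volume {x : ℝ × ℝ | wedge a x = 0} = 0 := by
  let f : (ℝ × ℝ) →ₗ[ℝ] ℝ := a.1 • LinearMap.snd ℝ ℝ ℝ - a.2 • LinearMap.fst ℝ ℝ ℝ
  have h : {x : ℝ × ℝ | wedge a x = 0} = (LinearMap.ker f : Set (ℝ × ℝ)) := by
    ext x; simp [f, wedge]
  rw [h]
  apply Measure.addHaar_submodule
  intro htop
  rw [LinearMap.ker_eq_top] at htop
  apply ha
  have h1 := LinearMap.congr_fun htop (1, 0)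
  have h2 := LinearMap.congr_fun htop (0, 1)
  simp [f] at h1 h2
  exact Prod.ext h2 h1

/-- The half-open standard triangle. -/
def stdTriangle : Set (ℝ × ℝ) := {x | 0 < x.1 ∧ 0 < x.2 ∧ x.1 + x.2 ≤ 1}

lemma volume_stdTriangle_pos : 0 < (volume stdTriangle).toReal := by
  refine ENNReal.toReal_pos ?_ ?_
  · have ho : IsOpen {x : ℝ × ℝ | 0 < x.1 ∧ 0 < x.2 ∧ x.1 + x.2 < 1} := by
      exact (isOpen_lt continuous_const continuous_fst).and
        ((isOpen_lt continuous_const continuous_snd).and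
          (isOpen_lt (continuous_fst.add continuous_snd) continuous_const))
    have hne : ({x : ℝ × ℝ | 0 < x.1 ∧ 0 < x.2 ∧ x.1 + x.2 < 1}).Nonempty :=
      ⟨(1 / 4, 1 / 4), by norm_num⟩
    have hpos := ho.measure_pos volume hne
    have hsub : {x : ℝ × ℝ | 0 < x.1 ∧ 0 < x.2 ∧ x.1 + x.2 < 1} ⊆ stdTriangle :=
      fun x ⟨h1, h2, h3⟩ => ⟨h1, h2, h3.le⟩
    exact (hpos.trans_le (measure_mono hsub)).ne'
  · have hsub : stdTriangle ⊆ Icc (0, 0) (1, 1) := by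
      rintro x ⟨h1, h2, h3⟩
      exact ⟨⟨h1.le, h2.le⟩, ⟨by simp; linarith, by simp; linarith⟩⟩
    exact ((measure_mono hsub).trans_lt isCompact_Icc.measure_lt_top).ne

/-- The linear map sending the standard basis of the plane to `a, b`. -/
def planeMap (a b : ℝ × ℝ) : (ℝ × ℝ) →ₗ[ℝ] (ℝ × ℝ) :=
  Matrix.toLin (Module.Basis.finTwoProd ℝ) (Module.Basis.finTwoProd ℝ) !![a.1, b.1; a.2, b.2]

lemma planeMap_apply (a b x : ℝ × ℝ) :
    planeMap a b x = (a.1 * x.1 + b.1 * x.2, a.2 * x.1 + b.2 * x.2) := by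
  rw [planeMap, Matrix.toLin_finTwoProd_apply]

lemma det_planeMap (a b : ℝ × ℝ) : LinearMap.det (planeMap a b) = wedge a b := by
  rw [planeMap, LinearMap.det_toLin, Matrix.det_fin_two_of, wedge]
  ring

/-- The open sector from `a` to `b`, counterclockwise. -/
def sector (a b : ℝ × ℝ) : Set (ℝ × ℝ) := {x | 0 < wedge a x ∧ 0 < wedge x b}

/-- The symmetric hexagon with vertices `±a, ±b, ±c`. -/
def hexHull (a b c : ℝ × ℝ) : Set (ℝ × ℝ) := convexHull ℝ {a, b, c, -a, -b, -c}

lemma hexHull_rotate (a b c : ℝ × ℝ) : hexHull b c (-a) = hexHull a b c := by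
  unfold hexHull
  congr 1
  ext x
  simp only [mem_insert_iff, mem_singleton_iff, neg_neg]
  tauto

lemma hexHull_mem_neg (a b c : ℝ × ℝ) : -hexHull a b c = hexHull a b c := by
  unfold hexHull
  rw [← convexHull_neg]
  congr 1
  ext x
  simp only [Set.mem_neg, mem_insert_iff, mem_singleton_iff, neg_eq_iff_eq_neg, neg_neg]
  tauto

lemma wedge_le_of_mem_hexHull {a b c : ℝ × ℝ}
    (h1 : wedge a b ≤ wedge b c + wedge a c) (h2 : wedge b c ≤ wedge a b + wedge a c)
    (h3 : wedge a c ≤ wedge a b + wedge b c) {x : ℝ × ℝ} (hx : x ∈ hexHull a b c) :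
    wedge a x + wedge x b ≤ wedge a b := by
  have hc : Convex ℝ {x : ℝ × ℝ | wedge a x + wedge x b ≤ wedge a b} := by
    intro x hx y hy s t hs ht hst
    simp only [mem_ofPred_eq, wedge, Prod.fst_add, Prod.snd_add, Prod.smul_fst, Prod.smul_snd,
      smul_eq_mul] at hx hy ⊢
    have e1 := mul_le_mul_of_nonneg_left hx hs
    have e2 := mul_le_mul_of_nonneg_left hy ht
    have e3 : a.1 * b.2 - a.2 * b.1 = s * (a.1 * b.2 - a.2 * b.1) + t * (a.1 * b.2 - a.2 * b.1) := by
      rw [← add_mul, hst, one_mul]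
    linarith
  refine convexHull_min ?_ hc hx
  intro y hy
  simp only [mem_insert_iff, mem_singleton_iff] at hy
  rw [mem_ofPred_eq]
  clear hc hx
  unfold wedge at *
  rcases hy with rfl | rfl | rfl | rfl | rfl | rfl <;>
    (try simp only [Prod.fst_neg, Prod.snd_neg]) <;> linarith

lemma zero_mem_hexHull (a b c : ℝ × ℝ) : (0 : ℝ × ℝ) ∈ hexHull a b c := by
  have h := (convex_convexHull ℝ {a, b, c, -a, -b, -c})
    (subset_convexHull ℝ _ (show a ∈ ({a, b, c, -a, -b, -c} : Set (ℝ × ℝ)) by simp))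
    (subset_convexHull ℝ _ (show -a ∈ ({a, b, c, -a, -b, -c} : Set (ℝ × ℝ)) by simp))
    (show (0 : ℝ) ≤ 1 / 2 by norm_num) (show (0 : ℝ) ≤ 1 / 2 by norm_num) (by norm_num)
  rw [hexHull]
  convert h using 1
  simp

lemma volume_hexHull_inter_sector {a b c : ℝ × ℝ}
    (h1 : wedge a b ≤ wedge b c + wedge a c) (h2 : wedge b c ≤ wedge a b + wedge a c)
    (h3 : wedge a c ≤ wedge a b + wedge b c) (hpos : 0 < wedge a b + wedge b c + wedge a c) :
    volume (hexHull a b c ∩ sector a b) = ENNReal.ofReal (wedge a b) * volume stdTriangle := by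
  have hA : 0 ≤ wedge a b := by linarith
  have hset : hexHull a b c ∩ sector a b = if wedge a b = 0 then ∅ else
      planeMap a b '' stdTriangle := by
    split_ifs with h0
    · rw [eq_empty_iff_forall_notMem]
      rintro x ⟨-, hx1, hx2⟩
      have key : wedge x b * wedge a c + wedge a x * wedge b c = wedge a b * wedge x c := by
        unfold wedge; ring
      rw [h0, zero_mul] at key
      have e : wedge b c = wedge a c := by linarith
      rw [e] at key
      have : 0 < wedge a c := by linarith
      have := mul_pos hx1 this
      have := mul_pos hx2 ‹0 < wedge a c›
      linarith
    · have hA' : 0 < wedge a b := lt_of_le_of_ne hA (Ne.symm h0)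
      ext x
      constructor
      · rintro ⟨hx, hx1, hx2⟩
        refine ⟨(wedge x b / wedge a b, wedge a x / wedge a b),
          ⟨by simp only; positivity, by simp only; positivity, ?_⟩, ?_⟩
        · have := wedge_le_of_mem_hexHull h1 h2 h3 hx
          simp only
          rw [← add_div, div_le_one hA']
          linarith
        · rw [planeMap_apply]
          ext
          · simp only
            field_simp
            unfold wedge; ring
          · simp only
            field_simp
            unfold wedge; ring
      · rintro ⟨y, ⟨hy1, hy2, hy3⟩, rfl⟩
        refine ⟨?_, ?_, ?_⟩
        · have hr : 0 < y.1 + y.2 := add_pos hy1 hy2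
          have hZ : Convex ℝ (hexHull a b c) := convex_convexHull ℝ _
          have haZ : a ∈ hexHull a b c := subset_convexHull ℝ _ (by simp)
          have hbZ : b ∈ hexHull a b c := subset_convexHull ℝ _ (by simp)
          have hm := hZ haZ hbZ (div_pos hy1 hr).le (div_pos hy2 hr).le
            (by rw [← add_div, div_self hr.ne'])
          have hab := hZ hm (zero_mem_hexHull a b c) hr.le (sub_nonneg.2 hy3) (by ring)
          convert hab using 1
          rw [planeMap_apply]
          ext
          · simp
            field_simp
          · simp
            field_simp
        · rw [planeMap_apply]
          have : 0 < y.2 * wedge a b := by positivity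
          unfold wedge at this ⊢
          simp only
          linarith
        · rw [planeMap_apply]
          have : 0 < y.1 * wedge a b := by positivity
          unfold wedge at this ⊢
          simp only
          linarith
  rw [hset]
  split_ifs with h0
  · simp [h0]
  · rw [Measure.addHaar_image_linearMap, det_planeMap, abs_of_nonneg hA]

lemma volume_hexHull {a b c : ℝ × ℝ}
    (h1 : wedge a b ≤ wedge b c + wedge a c) (h2 : wedge b c ≤ wedge a b + wedge a c)
    (h3 : wedge a c ≤ wedge a b + wedge b c) (hpos : 0 < wedge a b + wedge b c + wedge a c) :
    (volume (hexHull a b c)).toReal =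
      2 * (wedge a b + wedge b c + wedge a c) * (volume stdTriangle).toReal := by
  have hA : 0 ≤ wedge a b := by linarith
  have hB : 0 ≤ wedge b c := by linarith
  have hC : 0 ≤ wedge a c := by linarith
  have ha : a ≠ 0 := by
    rintro rfl
    simp [wedge] at *; linarith
  have hb : b ≠ 0 := by
    rintro rfl
    simp [wedge] at *; linarith
  have hc : c ≠ 0 := by
    rintro rfl
    simp [wedge] at *; linarith
  have r1 : wedge c (-a) = wedge a c := by simp [wedge]; ring
  have r2 : wedge b (-a) = wedge a b := by simp [wedge]; ring
  have r3 : wedge (-a) (-b) = wedge a b := by simp [wedge]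
  have r4 : wedge c (-b) = wedge b c := by simp [wedge]; ring
  have S1 := volume_hexHull_inter_sector h1 h2 h3 hpos
  have S2 : volume (hexHull a b c ∩ sector b c) =
      ENNReal.ofReal (wedge b c) * volume stdTriangle := by
    rw [← hexHull_rotate]
    apply volume_hexHull_inter_sector <;> rw [r1, r2] <;> linarith
  have S3 : volume (hexHull a b c ∩ sector c (-a)) =
      ENNReal.ofReal (wedge a c) * volume stdTriangle := by
    rw [← hexHull_rotate, ← hexHull_rotate, volume_hexHull_inter_sector, r1] <;>
      rw [r1, r3, r4] <;> linarith
  have key : ∀ x, wedge a b * wedge c x + wedge b c * wedge a x = wedge a c * wedge b x := by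
    intro x; unfold wedge; ring
  have anti : ∀ x y, wedge x y = -wedge y x := by
    intro x y; unfold wedge; ring
  have anti' : ∀ x, wedge x (-a) = wedge a x := by
    intro x; simp [wedge]; ring
  set Z := hexHull a b c with hZ
  have cont : ∀ d : ℝ × ℝ, Measurable (wedge d) := by
    intro d; unfold wedge; fun_prop
  have mpos : ∀ d : ℝ × ℝ, MeasurableSet {x | 0 < wedge d x} := fun d =>
    measurableSet_lt measurable_const (cont d)
  have mneg : ∀ d : ℝ × ℝ, MeasurableSet {x | wedge d x < 0} := fun d =>
    measurableSet_lt (cont d) measurable_const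
  have ae0 : ∀ {d : ℝ × ℝ}, d ≠ 0 → ∀ᵐ x : ℝ × ℝ, wedge d x ≠ 0 := by
    intro d hd
    exact measure_eq_zero_iff_ae_notMem.1 (volume_wedge_eq_zero hd)
  set U := Z ∩ {x | 0 < wedge a x} with hU
  have hUvol : volume U = ENNReal.ofReal (wedge a c) * volume stdTriangle +
      (ENNReal.ofReal (wedge a b) * volume stdTriangle +
        ENNReal.ofReal (wedge b c) * volume stdTriangle) := by
    rw [← S1, ← S2, ← S3, ← measure_inter_add_sdiff U (mpos c),
      ← measure_inter_add_sdiff (U \ _) (mneg b)]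
    congr 1
    · congr 1
      ext x
      simp only [hU, sector, mem_inter_iff, mem_ofPred_eq, anti']
      tauto
    congr 1
    · congr 1
      ext x
      simp only [hU, sector, mem_inter_iff, mem_ofPred_eq, Set.mem_sdiff, anti x b, Left.neg_pos_iff]
      constructor
      · tauto
      · rintro ⟨hx, hx1, hx2⟩
        refine ⟨⟨⟨hx, hx1⟩, ?_⟩, hx2⟩
        intro hx3
        have := key x
        have e1 := mul_nonneg hA hx3.le
        have e2 := mul_nonneg hB hx1.le
        have e3 := mul_nonneg hC (neg_nonneg.2 hx2.le)
        have z1 : wedge a b * wedge c x = 0 := by linarith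
        have z2 : wedge b c * wedge a x = 0 := by linarith
        have z1 := (mul_eq_zero.1 z1).resolve_right hx3.ne'
        have z2 := (mul_eq_zero.1 z2).resolve_right hx1.ne'
        linarith
    · apply measure_congr
      filter_upwards [ae0 ha, ae0 hb, ae0 hc] with x na nb nc
      apply propext
      change x ∈ (U \ {x | 0 < wedge c x}) \ {x | wedge b x < 0} ↔ x ∈ Z ∩ sector b c
      simp only [hU, sector, mem_inter_iff, mem_ofPred_eq, Set.mem_sdiff, anti x c, Left.neg_pos_iff,
        not_lt]
      constructor
      · rintro ⟨⟨⟨hx, hx1⟩, hx2⟩, hx3⟩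
        exact ⟨hx, lt_of_le_of_ne hx3 (Ne.symm nb), lt_of_le_of_ne hx2 nc⟩
      · rintro ⟨hx, hx1, hx2⟩
        refine ⟨⟨⟨hx, ?_⟩, hx2.le⟩, hx1.le⟩
        by_contra hx3
        have := key x
        have e1 := mul_nonneg hA (neg_nonneg.2 hx2.le)
        have e2 := mul_nonneg hB (neg_nonneg.2 (not_lt.1 hx3))
        have e3 := mul_nonneg hC hx1.le
        have z1 : wedge a b * wedge c x = 0 := by linarith
        have z2 : wedge a c * wedge b x = 0 := by linarith
        have z1 := (mul_eq_zero.1 z1).resolve_right hx2.ne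
        have z2 := (mul_eq_zero.1 z2).resolve_right hx1.ne'
        linarith
  have hneg : volume (Z \ {x | 0 < wedge a x}) = volume U := by
    rw [← Measure.measure_neg volume U]
    apply measure_congr
    filter_upwards [ae0 ha] with x na
    apply propext
    change x ∈ Z \ {x | 0 < wedge a x} ↔ -x ∈ U
    have hx : x ∈ Z ↔ -x ∈ Z := by
      conv_lhs => rw [hZ, ← hexHull_mem_neg]
      rfl
    have hw : wedge a (-x) = -wedge a x := by simp [wedge]; ring
    simp only [hU, Set.mem_sdiff, mem_inter_iff, mem_ofPred_eq, ← hx, hw, not_lt, Left.neg_pos_iff]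
    rw [le_iff_lt_or_eq]
    tauto
  rw [← measure_inter_add_sdiff Z (mpos a), hneg, ← hU, hUvol, ← add_mul, ← add_mul,
    ← ENNReal.ofReal_add hA hB, ← ENNReal.ofReal_add hC (by positivity), ← two_mul,
    ENNReal.toReal_mul, ENNReal.toReal_mul, ENNReal.toReal_ofReal (by positivity)]
  simp only [ENNReal.toReal_ofNat]
  ring

lemma volume_hexHull_eq_zero {a b c : ℝ × ℝ}
    (hab : wedge a b = 0) (hbc : wedge b c = 0) (hac : wedge a c = 0) :
    volume (hexHull a b c) = 0 := by
  have hc : ∀ d : ℝ × ℝ, Convex ℝ {x : ℝ × ℝ | wedge d x = 0} := by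
    intro d x hx y hy s t _ _ _
    simp only [mem_ofPred_eq, wedge, Prod.fst_add, Prod.snd_add, Prod.smul_fst, Prod.smul_snd,
      smul_eq_mul] at hx hy ⊢
    linear_combination s * hx + t * hy
  have hsub : ∃ d : ℝ × ℝ, d ≠ 0 ∧ hexHull a b c ⊆ {x : ℝ × ℝ | wedge d x = 0} := by
    by_cases ha : a = 0
    · by_cases hb : b = 0
      · by_cases hc0 : c = 0
        · refine ⟨(1, 0), by simp, convexHull_min ?_ (hc _)⟩
          intro y hy
          simp [ha, hb, hc0] at hy
          simp [hy, wedge]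
        · refine ⟨c, hc0, convexHull_min ?_ (hc _)⟩
          intro y hy
          simp only [mem_insert_iff, mem_singleton_iff] at hy
          rcases hy with rfl | rfl | rfl | rfl | rfl | rfl <;> simp [wedge] at * <;> linarith
      · refine ⟨b, hb, convexHull_min ?_ (hc _)⟩
        intro y hy
        simp only [mem_insert_iff, mem_singleton_iff] at hy
        rcases hy with rfl | rfl | rfl | rfl | rfl | rfl <;> simp [wedge] at * <;> linarith
    · refine ⟨a, ha, convexHull_min ?_ (hc _)⟩
      intro y hy
      simp only [mem_insert_iff, mem_singleton_iff] at hy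
      rcases hy with rfl | rfl | rfl | rfl | rfl | rfl <;> simp [wedge] at * <;> linarith
  obtain ⟨d, hd, hsub⟩ := hsub
  exact measure_mono_null hsub (volume_wedge_eq_zero hd)

end Volume

section WedgeAlgebra

lemma wedge_add_left (a b c : ℝ × ℝ) : wedge (a + b) c = wedge a c + wedge b c := by
  simp only [wedge, Prod.fst_add, Prod.snd_add]; ring

lemma wedge_add_right (a b c : ℝ × ℝ) : wedge a (b + c) = wedge a b + wedge a c := by
  simp only [wedge, Prod.fst_add, Prod.snd_add]; ring

lemma wedge_sub_left (a b c : ℝ × ℝ) : wedge (a - b) c = wedge a c - wedge b c := by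
  simp only [wedge, Prod.fst_sub, Prod.snd_sub]; ring

lemma wedge_sub_right (a b c : ℝ × ℝ) : wedge a (b - c) = wedge a b - wedge a c := by
  simp only [wedge, Prod.fst_sub, Prod.snd_sub]; ring

lemma wedge_neg_left (a b : ℝ × ℝ) : wedge (-a) b = -wedge a b := by
  simp only [wedge, Prod.fst_neg, Prod.snd_neg]; ring

lemma wedge_neg_right (a b : ℝ × ℝ) : wedge a (-b) = -wedge a b := by
  simp only [wedge, Prod.fst_neg, Prod.snd_neg]; ring

lemma wedge_smul_left (r : ℝ) (a b : ℝ × ℝ) : wedge (r • a) b = r * wedge a b := by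
  simp only [wedge, Prod.smul_fst, Prod.smul_snd, smul_eq_mul]; ring

lemma wedge_smul_right (r : ℝ) (a b : ℝ × ℝ) : wedge a (r • b) = r * wedge a b := by
  simp only [wedge, Prod.smul_fst, Prod.smul_snd, smul_eq_mul]; ring

lemma wedge_self (a : ℝ × ℝ) : wedge a a = 0 := by
  simp only [wedge]; ring

lemma wedge_swap (a b : ℝ × ℝ) : wedge a b = -wedge b a := by
  simp only [wedge]; ring

lemma wedge_zero_left (b : ℝ × ℝ) : wedge 0 b = 0 := by simp [wedge]

lemma wedge_zero_right (b : ℝ × ℝ) : wedge b 0 = 0 := by simp [wedge]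

lemma continuous_wedge : Continuous fun x : (ℝ × ℝ) × (ℝ × ℝ) => wedge x.1 x.2 := by
  unfold wedge; fun_prop

/-- Cramer's rule. -/
lemma wedge_smul_eq (a b x : ℝ × ℝ) :
    wedge a b • x = wedge x b • a + wedge a x • b := by
  ext <;> simp [wedge] <;> ring

/-- A vector parallel to `a ≠ 0` is a multiple of `a`. -/
lemma exists_eq_smul_of_wedge_eq_zero {a x : ℝ × ℝ} (ha : a ≠ 0) (h : wedge a x = 0) :
    ∃ r : ℝ, x = r • a := by
  by_cases h1 : a.1 = 0
  · have h2 : a.2 ≠ 0 := fun h2 => ha (Prod.ext h1 h2)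
    refine ⟨x.2 / a.2, Prod.ext ?_ ?_⟩
    · simp only [wedge, h1, zero_mul, zero_sub, neg_eq_zero, mul_eq_zero, h2, false_or] at h
      simp [h1, h]
    · simp [h2]
  · refine ⟨x.1 / a.1, Prod.ext ?_ ?_⟩
    · simp [h1]
    · simp only [wedge] at h
      simp only [Prod.smul_snd, smul_eq_mul]
      field_simp
      linarith

lemma abs_wedge_le (a b : ℝ × ℝ) : |wedge a b| ≤ 2 * ‖a‖ * ‖b‖ := by
  have h1 := norm_fst_le a
  have h2 := norm_snd_le a
  have h3 := norm_fst_le b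
  have h4 := norm_snd_le b
  have e1 := mul_le_mul h1 h4 (norm_nonneg _) (norm_nonneg _)
  have e2 := mul_le_mul h2 h3 (norm_nonneg _) (norm_nonneg _)
  rw [← norm_mul] at e1 e2
  have e3 := norm_sub_le (a.1 * b.2) (a.2 * b.1)
  rw [Real.norm_eq_abs] at e3
  unfold wedge
  linarith

end WedgeAlgebra

section Hexagon

lemma hexagon_area {K : Set (ℝ × ℝ)} (hint : (interior K).Nonempty) {w : ZMod 6 → ℝ × ℝ}
    (hw : IsBalancedHexagon K w) :
    0 < wedge (midpoint ℝ (w 0) (w 1)) (midpoint ℝ (w 2) (w 3)) ∧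
    (volume (convexHull ℝ (range w))).toReal =
      8 * wedge (midpoint ℝ (w 0) (w 1)) (midpoint ℝ (w 2) (w 3)) *
        (volume stdTriangle).toReal := by
  obtain ⟨hs, he, hK, -⟩ := hw
  have w3 : w 3 = -w 0 := hs 0
  have w4 : w 4 = -w 1 := hs 1
  have w5 : w 5 = -w 2 := hs 2
  have hrange : convexHull ℝ (range w) = hexHull (w 0) (w 1) (w 2) := by
    unfold hexHull
    rw [← w3, ← w4, ← w5]
    congr 1
    ext x
    simp only [mem_range, mem_insert_iff, mem_singleton_iff]
    constructor
    · rintro ⟨j, rfl⟩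
      have hj : j = 0 ∨ j = 1 ∨ j = 2 ∨ j = 3 ∨ j = 4 ∨ j = 5 := by
        revert j; decide
      rcases hj with rfl | rfl | rfl | rfl | rfl | rfl <;> simp
    · rintro (h | h | h | h | h | h) <;> exact ⟨_, h.symm⟩
  have e0 : 0 ≤ wedge (w 1 - w 0) (w 2 - w 1) := he 0
  have e1 : 0 ≤ wedge (w 2 - w 1) (w 3 - w 2) := he 1
  have e2 : 0 ≤ wedge (w 3 - w 2) (w 4 - w 3) := he 2
  have hu : 4 * wedge (midpoint ℝ (w 0) (w 1)) (midpoint ℝ (w 2) (w 3)) =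
      wedge (w 0) (w 1) + wedge (w 1) (w 2) + wedge (w 0) (w 2) := by
    rw [midpoint_eq_smul_add, midpoint_eq_smul_add, w3]
    simp only [wedge, invOf_eq_inv, Prod.smul_fst, Prod.smul_snd, Prod.fst_add, Prod.snd_add,
      Prod.fst_neg, Prod.snd_neg, smul_eq_mul]
    ring
  rw [w4, w3] at e2
  rw [w3] at e1
  have a1 : wedge (w 0) (w 1) ≤ wedge (w 1) (w 2) + wedge (w 0) (w 2) := by
    simp only [wedge, Prod.fst_sub, Prod.snd_sub, Prod.fst_neg, Prod.snd_neg] at e1 ⊢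
    linarith
  have a2 : wedge (w 1) (w 2) ≤ wedge (w 0) (w 1) + wedge (w 0) (w 2) := by
    simp only [wedge, Prod.fst_sub, Prod.snd_sub, Prod.fst_neg, Prod.snd_neg] at e2 ⊢
    linarith
  have a3 : wedge (w 0) (w 2) ≤ wedge (w 0) (w 1) + wedge (w 1) (w 2) := by
    simp only [wedge, Prod.fst_sub, Prod.snd_sub] at e0 ⊢
    linarith
  have hpos : 0 < wedge (w 0) (w 1) + wedge (w 1) (w 2) + wedge (w 0) (w 2) := by
    by_contra hneg
    have h0 : volume (hexHull (w 0) (w 1) (w 2)) = 0 :=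
      volume_hexHull_eq_zero (by linarith) (by linarith) (by linarith)
    rw [← hrange] at h0
    have := isOpen_interior.measure_pos volume hint
    exact this.ne' (measure_mono_null (interior_subset.trans hK) h0)
  refine ⟨by linarith, ?_⟩
  rw [hrange, volume_hexHull a1 a2 a3 hpos, ← hu]
  ring

lemma IsBalancedHexagon.rotate {K : Set (ℝ × ℝ)} {w : ZMod 6 → ℝ × ℝ}
    (hw : IsBalancedHexagon K w) (k : ZMod 6) : IsBalancedHexagon K fun j => w (k + j) := by
  obtain ⟨hs, he, hK, hm⟩ := hw
  refine ⟨fun j => ?_, fun j => ?_, ?_, fun j => ?_⟩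
  · simpa only [add_assoc] using hs (k + j)
  · simpa only [add_assoc] using he (k + j)
  · have : range (fun j => w (k + j)) = range w := (Equiv.addLeft k).surjective.range_comp w
    rwa [this]
  · simpa only [add_assoc] using hm (k + j)

lemma IsBalancedHexagon.midpoint_relation {K : Set (ℝ × ℝ)} {w : ZMod 6 → ℝ × ℝ}
    (hw : IsBalancedHexagon K w) :
    midpoint ℝ (w 4) (w 5) = -midpoint ℝ (w 0) (w 1) - midpoint ℝ (w 2) (w 3) ∧
    midpoint ℝ (w 0) (w 1) + midpoint ℝ (w 2) (w 3) = midpoint ℝ (w 1) (w 2) := by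
  have w3 : w 3 = -w 0 := hw.1 0
  have w4 : w 4 = -w 1 := hw.1 1
  have w5 : w 5 = -w 2 := hw.1 2
  rw [w3, w4, w5]
  simp only [midpoint_eq_smul_add]
  constructor <;> module

/-- Three pairwise alternate midpoints `u, v, -(u + v)` of a hexagon of normalized area `κ`. -/
structure IsTriple (K : Set (ℝ × ℝ)) (κ : ℝ) (u v : ℝ × ℝ) : Prop where
  left : u ∈ frontier K
  right : v ∈ frontier K
  add : u + v ∈ frontier K
  wedge_eq : wedge u v = κ

lemma IsHexameral.exists_triple {K : Set (ℝ × ℝ)} (hK : IsHexameral K) :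
    ∃ κ : ℝ, (∀ w, IsBalancedHexagon K w → 0 < κ ∧
      IsTriple K κ (midpoint ℝ (w 0) (w 1)) (midpoint ℝ (w 2) (w 3))) ∧
      ∀ p ∈ frontier K, ∃ v, IsTriple K κ p v := by
  obtain ⟨⟨-, -, hint, -⟩, -, hp, A, hA⟩ := hK
  have main : ∀ w, IsBalancedHexagon K w → 0 < A / (8 * (volume stdTriangle).toReal) ∧
      IsTriple K (A / (8 * (volume stdTriangle).toReal))
        (midpoint ℝ (w 0) (w 1)) (midpoint ℝ (w 2) (w 3)) := by
    intro w hw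
    obtain ⟨h1, h2⟩ := hexagon_area hint hw
    have hc := volume_stdTriangle_pos
    have hk : wedge (midpoint ℝ (w 0) (w 1)) (midpoint ℝ (w 2) (w 3)) =
        A / (8 * (volume stdTriangle).toReal) := by
      rw [hA w hw] at h2
      rw [h2]
      field_simp
    refine ⟨hk ▸ h1, hw.2.2.2 0, hw.2.2.2 2, ?_, hk⟩
    rw [hw.midpoint_relation.2]
    exact hw.2.2.2 1
  refine ⟨_, main, fun p hpf => ?_⟩
  obtain ⟨w, hw, j, rfl⟩ := hp p hpf
  have := (main _ (hw.rotate j)).2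
  rw [add_zero] at this
  exact ⟨_, this⟩

end Hexagon

section Support

/-- `τ` is the tangent vector of `K` at `p`, normalized by `wedge p τ = 1`. -/
def IsTangent (K : Set (ℝ × ℝ)) (p τ : ℝ × ℝ) : Prop :=
  wedge p τ = 1 ∧ ∀ x ∈ K, wedge x τ ≤ 1

variable {K : Set (ℝ × ℝ)}

lemma IsCSCD.neg_mem (hK : IsCSCD K) {x : ℝ × ℝ} (hx : x ∈ K) : -x ∈ K := by
  rw [hK.2.2.2] at hx
  exact hx

lemma IsCSCD.neg_mem_frontier (hK : IsCSCD K) {x : ℝ × ℝ} (hx : x ∈ frontier K) :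
    -x ∈ frontier K := by
  have h : (Homeomorph.neg (ℝ × ℝ)) ⁻¹' frontier K = frontier K := by
    rw [Homeomorph.preimage_frontier]
    congr 1
    exact hK.2.2.2.symm
  rw [← h] at hx
  exact hx

lemma IsCSCD.frontier_subset (hK : IsCSCD K) : frontier K ⊆ K :=
  hK.2.1.isClosed.frontier_subset

lemma IsCSCD.zero_mem_interior (hK : IsCSCD K) : (0 : ℝ × ℝ) ∈ interior K := by
  obtain ⟨x, hx⟩ := hK.2.2.1
  have hx' : -x ∈ interior K := by
    have h : (Homeomorph.neg (ℝ × ℝ)) ⁻¹' interior K = interior K := by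
      rw [Homeomorph.preimage_interior]
      congr 1
      exact hK.2.2.2.symm
    rw [← h] at hx
    exact hx
  have := hK.1.interior hx hx' (show (0 : ℝ) ≤ 1 / 2 by norm_num)
    (show (0 : ℝ) ≤ 1 / 2 by norm_num) (by norm_num)
  simpa using this

/-- Small multiples of any vector lie in `K`. -/
lemma IsCSCD.exists_smul_mem (hK : IsCSCD K) (v : ℝ × ℝ) : ∃ ε : ℝ, 0 < ε ∧ ε • v ∈ K := by
  have h : Tendsto (fun ε : ℝ => ε • v) (𝓝[>] 0) (𝓝 0) := by
    have : Continuous fun ε : ℝ => ε • v := by fun_prop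
    simpa using (this.tendsto 0).mono_left nhdsWithin_le_nhds
  have h1 := h.eventually (mem_interior_iff_mem_nhds.1 hK.zero_mem_interior)
  obtain ⟨ε, h2, h3⟩ := (h1.and self_mem_nhdsWithin).exists
  exact ⟨ε, h3, h2⟩

lemma IsTangent.neg (hK : IsCSCD K) {p τ : ℝ × ℝ} (h : IsTangent K p τ) :
    IsTangent K (-p) (-τ) := by
  refine ⟨by rw [wedge_neg_left, wedge_neg_right, neg_neg, h.1], fun x hx => ?_⟩
  rw [wedge_neg_right, ← wedge_neg_left]
  exact h.2 _ (hK.neg_mem hx)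

lemma IsTangent.mem_frontier {p τ : ℝ × ℝ} (h : IsTangent K p τ) (hp : p ∈ K) :
    p ∈ frontier K := by
  refine ⟨subset_closure hp, fun hi => ?_⟩
  have ht : Tendsto (fun ε : ℝ => (1 + ε) • p) (𝓝[>] 0) (𝓝 p) := by
    have : Continuous fun ε : ℝ => (1 + ε) • p := by fun_prop
    simpa using (this.tendsto 0).mono_left nhdsWithin_le_nhds
  have h1 := ht.eventually (mem_interior_iff_mem_nhds.1 hi)
  obtain ⟨ε, h2, h3⟩ := (h1.and self_mem_nhdsWithin).exists
  have := h.2 _ h2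
  rw [wedge_smul_left, h.1] at this
  have h3 : 0 < ε := h3
  linarith

lemma exists_isTangent (hK : IsCSCD K) (hN : NoCorners K) {p : ℝ × ℝ} (hp : p ∈ frontier K) :
    ∃ τ, IsTangent K p τ := by
  obtain ⟨L, ⟨f, hf0, -, hf⟩, -⟩ := hN p hp
  have hfx : ∀ x : ℝ × ℝ, f x = x.1 * f (1, 0) + x.2 * f (0, 1) := by
    intro x
    have : x = x.1 • ((1 : ℝ), (0 : ℝ)) + x.2 • ((0 : ℝ), (1 : ℝ)) := by ext <;> simp
    conv_lhs => rw [this, map_add, map_smul, map_smul]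
    simp
  have hpos : 0 < f p := by
    have : ∃ v, f v ≠ 0 := by
      by_contra! h
      exact hf0 (LinearMap.ext h)
    obtain ⟨v, hv⟩ := this
    have : ∃ v, 0 < f v := by
      rcases lt_or_gt_of_ne hv with h | h
      · exact ⟨-v, by rw [map_neg]; linarith⟩
      · exact ⟨v, h⟩
    obtain ⟨v, hv⟩ := this
    obtain ⟨ε, hε, hmem⟩ := hK.exists_smul_mem v
    have := hf _ hmem
    rw [map_smul, smul_eq_mul] at this
    exact (mul_pos hε hv).trans_le this
  have key : ∀ x : ℝ × ℝ, wedge x (-(f (0, 1) / f p), f (1, 0) / f p) = f x / f p := by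
    intro x
    rw [hfx x]
    simp only [wedge]
    ring
  refine ⟨_, by rw [key, div_self hpos.ne'], fun x hx => ?_⟩
  rw [key, div_le_one hpos]
  exact hf x hx

lemma IsTangent.unique (hN : NoCorners K) {p τ τ' : ℝ × ℝ} (hp : p ∈ frontier K)
    (h : IsTangent K p τ) (h' : IsTangent K p τ') : τ = τ' := by
  have line : ∀ {σ : ℝ × ℝ}, IsTangent K p σ → IsSupportingLineAt K p {x | wedge x σ = 1} := by
    intro σ hσ
    let f : (ℝ × ℝ) →ₗ[ℝ] ℝ := σ.2 • LinearMap.fst ℝ ℝ ℝ - σ.1 • LinearMap.snd ℝ ℝ ℝ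
    have hf : ∀ x, f x = wedge x σ := by
      intro x; simp [f, wedge]; ring
    refine ⟨f, ?_, ?_, ?_⟩
    · intro h0
      have := hf p
      rw [h0, hσ.1] at this
      simp at this
    · ext x
      simp only [mem_ofPred_eq, hf, hσ.1]
    · intro x hx
      rw [hf, hf, hσ.1]
      exact hσ.2 x hx
  have heq := (hN p hp).unique (line h) (line h')
  have hmem : p + τ ∈ {x | wedge x τ = 1} := by
    simp only [mem_ofPred_eq, wedge_add_left, wedge_self, h.1, add_zero]
  rw [heq, mem_ofPred_eq, wedge_add_left, h'.1] at hmem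
  have h0 : wedge τ τ' = 0 := by linarith
  have e1 := wedge_smul_eq p τ τ'
  rw [h.1, h'.1, wedge_swap, h0] at e1
  simpa using e1.symm

end Support

section Triple

variable {K : Set (ℝ × ℝ)} {κ : ℝ}

lemma IsTriple.rotate (hK : IsCSCD K) {u v : ℝ × ℝ} (h : IsTriple K κ u v) :
    IsTriple K κ v (-(u + v)) := by
  refine ⟨h.right, hK.neg_mem_frontier h.add, ?_, ?_⟩
  · have : v + -(u + v) = -u := by abel
    rw [this]
    exact hK.neg_mem_frontier h.left
  · rw [wedge_neg_right, wedge_add_right, wedge_self, wedge_swap, h.wedge_eq]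
    ring

/-- Not both unit translates of a point of a face of `K` by a boundary vector parallel to the
face belong to `K`. -/
lemma not_both_translates_mem (hK : IsCSCD K) (hN : NoCorners K) {u p τ : ℝ × ℝ}
    (hu : u ∈ frontier K) (hτ : IsTangent K p τ) (huτ : wedge u τ = 0)
    (h1 : p + u ∈ K) (h2 : p - u ∈ K) : False := by
  obtain ⟨θ, hθ⟩ := exists_isTangent hK hN hu
  have e1 := hθ.2 _ h1
  have e2 := hθ.2 _ (hK.neg_mem h2)
  have hu1 := hθ.1
  rw [neg_sub, wedge_sub_left] at e2
  rw [wedge_add_left] at e1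
  have t1 : IsTangent K (p + u) θ := ⟨by rw [wedge_add_left]; linarith, hθ.2⟩
  have t2 : IsTangent K (p + u) τ := ⟨by rw [wedge_add_left, huτ, hτ.1, add_zero], hτ.2⟩
  have := t1.unique hN (t1.mem_frontier h1) t2
  rw [this, huτ] at hu1
  exact zero_ne_one hu1

/-- If neither unit translate of a point `p` of a face parallel to `u` lies in `K`, then the
tangent direction at `u` is that of `p`. -/
lemma wedge_tangent_eq_zero_of_translates (hK : IsCSCD K) (hκ : 0 < κ)
    (hp : ∀ p ∈ frontier K, ∃ v, IsTriple K κ p v)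
    {u p τ θ : ℝ × ℝ} (hθ : IsTangent K u θ) (hτ : IsTangent K p τ)
    (huτ : wedge u τ = 0) (hpK : p ∈ K) (hup : wedge u p = κ)
    (h1 : p + u ∉ K) (h2 : p - u ∉ K) : wedge p θ = 0 := by
  obtain ⟨v, hv⟩ := hp p (hτ.mem_frontier hpK)
  have hp0 : p ≠ 0 := by
    rintro rfl
    rw [wedge_zero_right] at hup
    exact hκ.ne hup
  obtain ⟨y, hy⟩ := exists_eq_smul_of_wedge_eq_zero hp0 (x := v + u)
    (by rw [wedge_add_right, hv.wedge_eq, wedge_swap, hup]; ring)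
  have hv' : v = y • p - u := by rw [← hy]; abel
  have hvK := hK.frontier_subset hv.right
  have hwK := hK.frontier_subset hv.add
  have y1 : -1 ≤ y := by
    have := hτ.2 _ (hK.neg_mem hvK)
    rw [hv', wedge_neg_left, wedge_sub_left, wedge_smul_left, hτ.1, huτ] at this
    linarith
  have y2 : y ≤ 0 := by
    have := hτ.2 _ hwK
    rw [hv', wedge_add_left, wedge_sub_left, wedge_smul_left, hτ.1, huτ] at this
    linarith
  have y3 : y ≠ 0 := by
    rintro rfl
    apply h2
    convert hwK using 1
    rw [hv']
    module
  have y4 : y ≠ -1 := by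
    rintro rfl
    apply h1
    convert hK.neg_mem hvK using 1
    rw [hv']
    module
  have y1' : -1 < y := lt_of_le_of_ne y1 (Ne.symm y4)
  have y2' : y < 0 := lt_of_le_of_ne y2 y3
  have b1 := hθ.2 _ (hK.neg_mem hvK)
  have b2 := hθ.2 _ (hK.neg_mem hwK)
  rw [hv', wedge_neg_left, wedge_sub_left, wedge_smul_left, hθ.1] at b1
  rw [hv', wedge_neg_left, wedge_add_left, wedge_sub_left, wedge_smul_left, hθ.1] at b2
  have c1 : 0 ≤ y * wedge p θ := by linarith
  have c2 : 0 ≤ (y + 1) * wedge p θ := by linarith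
  have d1 : wedge p θ ≤ 0 := by
    by_contra! h
    nlinarith
  have d2 : 0 ≤ wedge p θ := by
    by_contra! h
    nlinarith
  linarith

lemma IsTriple.wedge_tangent_ne_zero (hK : IsCSCD K) (hN : NoCorners K) (hκ : 0 < κ)
    (hp : ∀ p ∈ frontier K, ∃ v, IsTriple K κ p v)
    {u v τ : ℝ × ℝ} (h : IsTriple K κ u v) (hτ : IsTangent K v τ) : wedge u τ ≠ 0 := by
  intro huτ
  have hKc : IsClosed K := hK.2.1.isClosed
  have tang : ∀ c : ℝ, IsTangent K (v + c • u) τ := fun c =>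
    ⟨by rw [wedge_add_left, wedge_smul_left, huτ, hτ.1]; ring, hτ.2⟩
  have hmem : ∀ c ∈ Icc (0 : ℝ) 1, v + c • u ∈ K := by
    intro c hc
    have := hK.1 (hK.frontier_subset h.right) (hK.frontier_subset h.add)
      (sub_nonneg.2 hc.2) hc.1 (by ring)
    convert this using 1
    module
  have clA : IsClosed {c : ℝ | v + c • u + u ∈ K} :=
    hKc.preimage (f := fun c : ℝ => v + c • u + u) (by fun_prop)
  have clB : IsClosed {c : ℝ | v + c • u - u ∈ K} :=
    hKc.preimage (f := fun c : ℝ => v + c • u - u) (by fun_prop)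
  have m0 : (0 : ℝ) ∈ {c : ℝ | v + c • u + u ∈ K} := by
    have := hK.frontier_subset h.add
    rw [add_comm] at this
    simpa using this
  have m1 : (1 : ℝ) ∈ {c : ℝ | v + c • u - u ∈ K} := by
    simpa using hK.frontier_subset h.right
  have hex : ∃ c ∈ Icc (0 : ℝ) 1, v + c • u + u ∉ K ∧ v + c • u - u ∉ K := by
    by_contra! hcon
    obtain ⟨c, -, hA, hB⟩ := isPreconnected_closed_iff.1 (isPreconnected_Icc (a := (0 : ℝ)) (b := 1))
      _ _ clA clB (fun c hc => by
        by_cases hA : v + c • u + u ∈ K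
        · exact Or.inl hA
        · exact Or.inr (hcon c hc hA)) ⟨0, by simp, m0⟩ ⟨1, by simp, m1⟩
    exact not_both_translates_mem hK hN h.left (tang c) huτ hA hB
  obtain ⟨c, hc, hA, hB⟩ := hex
  have hc1 : c < 1 := lt_of_le_of_ne hc.2 (by rintro rfl; exact hB m1)
  have evA : ∀ᶠ d in 𝓝 c, v + d • u + u ∉ K := clA.isOpen_compl.mem_nhds hA
  have evB : ∀ᶠ d in 𝓝 c, v + d • u - u ∉ K := clB.isOpen_compl.mem_nhds hB
  have ev : ∀ᶠ d in 𝓝[>] c, (v + d • u + u ∉ K ∧ v + d • u - u ∉ K) ∧ d < 1 :=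
    ((evA.and evB).and (eventually_lt_nhds hc1)).filter_mono nhdsWithin_le_nhds
  obtain ⟨d, ⟨⟨hA', hB'⟩, hd1⟩, hd⟩ := (ev.and self_mem_nhdsWithin).exists
  have hd : c < d := hd
  obtain ⟨θ, hθ⟩ := exists_isTangent hK hN h.left
  have wedge_eq : ∀ c : ℝ, wedge u (v + c • u) = κ := fun c => by
    rw [wedge_add_right, wedge_smul_right, wedge_self, h.wedge_eq]; ring
  have r1 := wedge_tangent_eq_zero_of_translates hK hκ hp hθ (tang c) huτ (hmem c hc)
    (wedge_eq c) hA hB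
  have r2 := wedge_tangent_eq_zero_of_translates hK hκ hp hθ (tang d) huτ
    (hmem d ⟨hc.1.trans hd.le, hd1.le⟩) (wedge_eq d) hA' hB'
  rw [wedge_add_left, wedge_smul_left, hθ.1] at r1 r2
  linarith

lemma IsTriple.wedge_tangent_neg (hK : IsCSCD K) (hN : NoCorners K) (hκ : 0 < κ)
    (hp : ∀ p ∈ frontier K, ∃ v, IsTriple K κ p v)
    {u v τ : ℝ × ℝ} (h : IsTriple K κ u v) (hτ : IsTangent K v τ) : wedge u τ < 0 := by
  refine lt_of_le_of_ne ?_ (h.wedge_tangent_ne_zero hK hN hκ hp hτ)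
  have := hτ.2 _ (hK.frontier_subset h.add)
  rw [wedge_add_left, hτ.1] at this
  linarith

lemma IsTriple.wedge_tangent_neg' (hK : IsCSCD K) (hN : NoCorners K) (hκ : 0 < κ)
    (hp : ∀ p ∈ frontier K, ∃ v, IsTriple K κ p v)
    {u v τ : ℝ × ℝ} (h : IsTriple K κ u v) (hτ : IsTangent K u τ) : wedge v τ < 0 := by
  have hle : wedge v τ ≤ 0 := by
    have := hτ.2 _ (hK.frontier_subset h.add)
    rw [wedge_add_left, hτ.1] at this
    linarith
  refine lt_of_le_of_ne hle fun h0 => ?_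
  have hτ' : IsTangent K (-(u + v)) (-τ) := by
    refine IsTangent.neg hK ⟨?_, hτ.2⟩
    rw [wedge_add_left, h0, hτ.1, add_zero]
  have := (h.rotate hK).wedge_tangent_ne_zero hK hN hκ hp hτ'
  rw [wedge_neg_right, h0, neg_zero] at this
  exact this rfl

/-- The second midpoint is determined by the first one. -/
lemma IsTriple.eq_of_mem (hK : IsCSCD K) (hN : NoCorners K) (hκ : 0 < κ)
    (hp : ∀ p ∈ frontier K, ∃ v, IsTriple K κ p v)
    {u v v' : ℝ × ℝ} (h : IsTriple K κ u v) (h1 : v' ∈ K) (h2 : u + v' ∈ K)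
    (h3 : wedge u v' = κ) : v' = v := by
  have hu0 : u ≠ 0 := by
    rintro rfl
    rw [wedge_zero_left] at h3
    exact hκ.ne h3
  obtain ⟨s, hs⟩ := exists_eq_smul_of_wedge_eq_zero hu0 (x := v' - v)
    (by rw [wedge_sub_right, h3, h.wedge_eq, sub_self])
  have hv' : v' = v + s • u := by rw [← hs]; abel
  obtain ⟨τ, hτ⟩ := exists_isTangent hK hN h.right
  obtain ⟨θ, hθ⟩ := exists_isTangent hK hN (hK.neg_mem_frontier h.add)
  have n1 := h.wedge_tangent_neg hK hN hκ hp hτ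
  have n2 := ((h.rotate hK).rotate hK).wedge_tangent_neg' hK hN hκ hp hθ
  have e : -(v + -(u + v)) = u := by abel
  rw [e] at n2
  have b1 := hτ.2 _ h1
  have b2 := hθ.2 _ (hK.neg_mem h2)
  have e2 : -(u + v') = -(u + v) - s • u := by rw [hv']; abel
  rw [hv', wedge_add_left, wedge_smul_left, hτ.1] at b1
  rw [e2, wedge_sub_left, wedge_smul_left, hθ.1] at b2
  have s1 : 0 ≤ s := by
    by_contra! hs
    nlinarith
  have s2 : s ≤ 0 := by
    by_contra! hs
    nlinarith
  have s0 : s = 0 := le_antisymm s2 s1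
  rw [hv', s0, zero_smul, add_zero]

end Triple

section Regularity

variable {K : Set (ℝ × ℝ)} {κ : ℝ} {T : ℝ × ℝ → ℝ × ℝ}

lemma tendsto_wedge {α : Type*} {l : Filter α} {f g : α → ℝ × ℝ} {a b : ℝ × ℝ}
    (hf : Tendsto f l (𝓝 a)) (hg : Tendsto g l (𝓝 b)) :
    Tendsto (fun x => wedge (f x) (g x)) l (𝓝 (wedge a b)) :=
  (continuous_wedge.tendsto (a, b)).comp (hf.prodMk_nhds hg)

lemma continuousOn_tangent (hK : IsCSCD K) (hN : NoCorners K)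
    (hT : ∀ p ∈ frontier K, IsTangent K p (T p)) : ContinuousOn T (frontier K) := by
  obtain ⟨ε, hε, h1⟩ := hK.exists_smul_mem (1, 0)
  obtain ⟨δ, hδ, h2⟩ := hK.exists_smul_mem (0, 1)
  have hmem : ∀ p ∈ frontier K, T p ∈ Icc (-δ⁻¹, -ε⁻¹) (δ⁻¹, ε⁻¹) := by
    intro p hp
    have a1 := (hT p hp).2 _ h1
    have a2 := (hT p hp).2 _ (hK.neg_mem h1)
    have a3 := (hT p hp).2 _ h2
    have a4 := (hT p hp).2 _ (hK.neg_mem h2)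
    simp only [wedge, Prod.smul_mk, smul_eq_mul, mul_one, mul_zero, zero_mul, sub_zero, zero_sub,
      Prod.fst_neg, Prod.snd_neg, neg_mul, neg_neg, neg_zero] at a1 a2 a3 a4
    have e1 : ε * ε⁻¹ = 1 := mul_inv_cancel₀ hε.ne'
    have e2 : δ * δ⁻¹ = 1 := mul_inv_cancel₀ hδ.ne'
    refine ⟨⟨?_, ?_⟩, ⟨?_, ?_⟩⟩ <;> simp only
    · nlinarith
    · nlinarith
    · nlinarith
    · nlinarith
  intro p hp
  refine isCompact_Icc.tendsto_nhds_of_unique_mapClusterPt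
    (eventually_mem_nhdsWithin.mono hmem) fun y _ hy => ?_
  obtain ⟨U, hU, hy⟩ := mapClusterPt_iff_ultrafilter.1 hy
  have hid : Tendsto id (U : Filter (ℝ × ℝ)) (𝓝 p) := hU.trans nhdsWithin_le_nhds
  have hev : ∀ᶠ q in (U : Filter (ℝ × ℝ)), q ∈ frontier K := hU eventually_mem_nhdsWithin
  refine IsTangent.unique hN hp ⟨?_, fun x hx => ?_⟩ (hT p hp)
  · refine tendsto_nhds_unique (tendsto_wedge hid hy) (tendsto_const_nhds.congr' ?_)
    filter_upwards [hev] with q hq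
    exact (hT q hq).1.symm
  · refine le_of_tendsto (tendsto_wedge tendsto_const_nhds hy) ?_
    filter_upwards [hev] with q hq
    exact (hT q hq).2 x hx

lemma continuousOn_of_isTriple (hK : IsCSCD K) (hN : NoCorners K) (hκ : 0 < κ)
    (hp : ∀ p ∈ frontier K, ∃ v, IsTriple K κ p v) {σ ρ : ℝ → ℝ × ℝ} {s : Set ℝ}
    (hσ : ContinuousOn σ s) (h : ∀ t ∈ s, IsTriple K κ (σ t) (ρ t)) : ContinuousOn ρ s := by
  intro t ht
  refine hK.2.1.tendsto_nhds_of_unique_mapClusterPt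
    (eventually_mem_nhdsWithin.mono fun x hx => hK.frontier_subset (h x hx).right)
    fun y hyK hy => ?_
  obtain ⟨U, hU, hy⟩ := mapClusterPt_iff_ultrafilter.1 hy
  have hσU : Tendsto σ (U : Filter ℝ) (𝓝 (σ t)) := (hσ t ht).mono_left hU
  have hev : ∀ᶠ x in (U : Filter ℝ), x ∈ s := hU eventually_mem_nhdsWithin
  refine (h t ht).eq_of_mem hK hN hκ hp hyK ?_ ?_
  · refine hK.2.1.isClosed.mem_of_tendsto (hσU.add hy) ?_
    filter_upwards [hev] with x hx
    exact hK.frontier_subset (h x hx).add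
  · refine tendsto_nhds_unique (tendsto_wedge hσU hy) (tendsto_const_nhds.congr' ?_)
    filter_upwards [hev] with x hx
    exact (h x hx).wedge_eq.symm

lemma abs_wedge_tangent_le (hK : IsCSCD K) (hT : ∀ p ∈ frontier K, IsTangent K p (T p))
    {p q : ℝ × ℝ} (hp : p ∈ frontier K) (hq : q ∈ frontier K) :
    |wedge (q - p) (T p)| ≤ 2 * ‖q - p‖ * ‖T q - T p‖ := by
  have h1 := (hT p hp).2 _ (hK.frontier_subset hq)
  have h2 := (hT q hq).2 _ (hK.frontier_subset hp)
  have h3 := abs_wedge_le (q - p) (T q - T p)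
  refine le_trans ?_ h3
  have h4 := (hT p hp).1
  have h5 := (hT q hq).1
  have e1 : wedge (q - p) (T p) ≤ 0 := by rw [wedge_sub_left]; linarith
  have e2 : 0 ≤ wedge (q - p) (T q) := by rw [wedge_sub_left]; linarith
  rw [wedge_sub_right, abs_of_nonpos e1, abs_of_nonneg (by linarith)]
  linarith

lemma isLittleO_wedge_tangent (hK : IsCSCD K) (hN : NoCorners K)
    (hT : ∀ p ∈ frontier K, IsTangent K p (T p)) {ρ : ℝ → ℝ × ℝ} {s : Set ℝ}
    (hρ : ContinuousOn ρ s) (hf : ∀ t ∈ s, ρ t ∈ frontier K) {t : ℝ} (ht : t ∈ s) :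
    (fun x => wedge (ρ x - ρ t) (T (ρ t))) =o[𝓝[s] t] fun x => ρ x - ρ t := by
  have hTρ : ContinuousOn (fun x => T (ρ x)) s :=
    (continuousOn_tangent hK hN hT).comp hρ hf
  have h0 : Tendsto (fun x => T (ρ x) - T (ρ t)) (𝓝[s] t) (𝓝 0) := by
    have h : Tendsto (fun x => T (ρ x)) (𝓝[s] t) (𝓝 (T (ρ t))) := hTρ t ht
    simpa using h.sub_const (T (ρ t))
  have h1 : (fun x => ‖ρ x - ρ t‖ * ‖T (ρ x) - T (ρ t)‖) =o[𝓝[s] t] fun x => ‖ρ x - ρ t‖ * 1 :=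
    (isBigO_refl _ _).mul_isLittleO ((isLittleO_one_iff ℝ).2 h0).norm_left
  simp only [mul_one] at h1
  refine IsBigO.trans_isLittleO (IsBigO.of_bound 2 ?_) h1.of_norm_right
  filter_upwards [self_mem_nhdsWithin] with x hx
  have := abs_wedge_tangent_le hK hT (hf t ht) (hf x hx)
  rw [Real.norm_eq_abs, Real.norm_eq_abs, abs_mul, abs_norm, abs_norm]
  linarith

/-- A derivative of a boundary curve is parallel to the tangent. -/
lemma wedge_deriv_tangent_eq_zero (hK : IsCSCD K) (hN : NoCorners K)
    (hT : ∀ p ∈ frontier K, IsTangent K p (T p)) {ρ : ℝ → ℝ × ℝ} {s : Set ℝ}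
    (hρ : ContinuousOn ρ s) (hf : ∀ t ∈ s, ρ t ∈ frontier K) {t : ℝ} (ht : t ∈ s)
    (hs : UniqueDiffWithinAt ℝ s t) {ρ' : ℝ × ℝ} (hd : HasDerivWithinAt ρ ρ' s t) :
    wedge ρ' (T (ρ t)) = 0 := by
  have h1 : HasDerivWithinAt (fun x => wedge (ρ x) (T (ρ t))) (wedge ρ' (T (ρ t))) s t := by
    have a1 : HasDerivWithinAt (fun x => (ρ x).1) ρ'.1 s t :=
      (ContinuousLinearMap.fst ℝ ℝ ℝ).hasFDerivAt.comp_hasDerivWithinAt t hd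
    have a2 : HasDerivWithinAt (fun x => (ρ x).2) ρ'.2 s t :=
      (ContinuousLinearMap.snd ℝ ℝ ℝ).hasFDerivAt.comp_hasDerivWithinAt t hd
    exact (a1.mul_const _).sub (a2.mul_const _)
  have h2 : HasDerivWithinAt (fun x => wedge (ρ x) (T (ρ t))) 0 s t := by
    rw [hasDerivWithinAt_iff_isLittleO]
    have := (isLittleO_wedge_tangent hK hN hT hρ hf ht).trans_isBigO hd.differentiableWithinAt.isBigO_sub
    simpa only [wedge_sub_left, smul_zero, sub_zero] using this
  exact hs.eq_deriv s h1 h2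

/-- Product rule at a zero of one factor, the other factor being merely continuous. -/
lemma hasDerivWithinAt_wedge_sub {f g : ℝ → ℝ × ℝ} {s : Set ℝ} {t : ℝ} {g' : ℝ × ℝ}
    (hf : ContinuousWithinAt f s t) (hg : HasDerivWithinAt g g' s t) :
    (fun x => wedge (f x) (g x - g t) - (x - t) * wedge (f t) g') =o[𝓝[s] t] fun x => x - t := by
  have h1 : (fun x => g x - g t - (x - t) • g') =o[𝓝[s] t] fun x => x - t :=
    hasDerivWithinAt_iff_isLittleO.1 hg
  have h2 : (fun x => g x - g t) =O[𝓝[s] t] fun x => x - t := hg.differentiableWithinAt.isBigO_sub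
  have h3 : Tendsto (fun x => f x - f t) (𝓝[s] t) (𝓝 0) := by
    have h : Tendsto f (𝓝[s] t) (𝓝 (f t)) := hf
    simpa using h.sub_const (f t)
  have h4 : (fun x => ‖f x - f t‖ * ‖g x - g t‖) =o[𝓝[s] t] fun x => (1 : ℝ) * (x - t) :=
    ((isLittleO_one_iff ℝ).2 h3).norm_left.mul_isBigO h2.norm_left
  simp only [one_mul] at h4
  have h5 : (fun x => wedge (f x - f t) (g x - g t)) =o[𝓝[s] t] fun x => x - t := by
    refine IsBigO.trans_isLittleO (IsBigO.of_bound 2 (Eventually.of_forall fun x => ?_)) h4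
    have := abs_wedge_le (f x - f t) (g x - g t)
    rw [Real.norm_eq_abs, Real.norm_eq_abs, abs_mul, abs_norm, abs_norm]
    linarith
  have h6 : (fun x => wedge (f t) (g x - g t - (x - t) • g')) =o[𝓝[s] t] fun x => x - t := by
    refine IsBigO.trans_isLittleO (IsBigO.of_bound (2 * ‖f t‖) (Eventually.of_forall fun x => ?_)) h1
    rw [Real.norm_eq_abs]
    exact abs_wedge_le _ _
  refine (h5.add h6).congr_left fun x => ?_
  simp only [wedge_sub_left, wedge_sub_right, wedge_smul_right]
  ring

/-- The derivative of a boundary curve `ρ` with `wedge σ ρ` constant. -/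
lemma hasDerivWithinAt_of_wedge_const (hK : IsCSCD K) (hN : NoCorners K)
    (hT : ∀ p ∈ frontier K, IsTangent K p (T p)) {σ ρ : ℝ → ℝ × ℝ} {s : Set ℝ}
    (hρ : ContinuousOn ρ s) (hf : ∀ t ∈ s, ρ t ∈ frontier K)
    (hc : ∀ t ∈ s, wedge (σ t) (ρ t) = κ) {t : ℝ} (ht : t ∈ s)
    (h0 : wedge (σ t) (T (ρ t)) ≠ 0) {σ' : ℝ × ℝ} (hd : HasDerivWithinAt σ σ' s t) :
    HasDerivWithinAt ρ ((wedge (ρ t) σ' / wedge (σ t) (T (ρ t))) • T (ρ t)) s t := by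
  set τ := T (ρ t) with hτ
  set D := wedge (σ t) τ with hD
  have ho := isLittleO_wedge_tangent hK hN hT hρ hf ht
  rw [← hτ] at ho
  have hb := hasDerivWithinAt_wedge_sub (hρ t ht) hd
  have hb' : (fun x => wedge (ρ x) (σ x - σ t)) =O[𝓝[s] t] fun x => x - t := by
    have h2 : (fun x => (x - t) * wedge (ρ t) σ') =O[𝓝[s] t] fun x => x - t := by
      simpa only [mul_comm] using isBigO_const_mul_self (wedge (ρ t) σ') (fun x => x - t) (𝓝[s] t)
    simpa using hb.isBigO.add h2
  have hcram : ∀ x ∈ s, ρ x - ρ t - (wedge (ρ x) (σ x - σ t) / D) • τ =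
      (D⁻¹ * wedge (ρ x - ρ t) τ) • σ t := by
    intro x hx
    have h1 := wedge_smul_eq (σ t) τ (ρ x - ρ t)
    have h2 : wedge (σ t) (ρ x - ρ t) = wedge (ρ x) (σ x - σ t) := by
      rw [wedge_sub_right, wedge_sub_right, hc t ht, wedge_swap (ρ x) (σ x), hc x hx,
        wedge_swap (ρ x) (σ t)]
      ring
    rw [h2, ← hD] at h1
    rw [sub_eq_iff_eq_add, div_eq_inv_mul, mul_smul, mul_smul, ← smul_add, ← h1,
      inv_smul_smul₀ h0]
  have hev : ∀ᶠ x in 𝓝[s] t, x ∈ s := eventually_mem_nhdsWithin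
  have h1 : (fun x => ρ x - ρ t - (wedge (ρ x) (σ x - σ t) / D) • τ) =o[𝓝[s] t]
      fun x => ρ x - ρ t := by
    have : (fun x => (D⁻¹ * wedge (ρ x - ρ t) τ) • σ t) =o[𝓝[s] t] fun x => ρ x - ρ t := by
      refine IsBigO.trans_isLittleO (IsBigO.of_bound (‖D⁻¹‖ * ‖σ t‖)
        (Eventually.of_forall fun x => ?_)) ho
      rw [norm_smul, norm_mul]
      exact le_of_eq (by ring)
    refine this.congr' ?_ EventuallyEq.rfl
    filter_upwards [hev] with x hx
    exact (hcram x hx).symm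
  have h2 : (fun x => (wedge (ρ x) (σ x - σ t) / D) • τ) =O[𝓝[s] t] fun x => x - t := by
    refine IsBigO.trans (IsBigO.of_bound (‖D⁻¹‖ * ‖τ‖) (Eventually.of_forall fun x => ?_)) hb'
    rw [norm_smul, div_eq_mul_inv, norm_mul]
    exact le_of_eq (by ring)
  have h3 : (fun x => ρ x - ρ t) =O[𝓝[s] t] fun x => x - t := by
    have heq : IsEquivalent (𝓝[s] t) (fun x => (wedge (ρ x) (σ x - σ t) / D) • τ)
        (fun x => ρ x - ρ t) := by
      refine h1.neg_left.congr_left fun x => ?_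
      simp
    exact heq.isBigO_symm.trans h2
  rw [hasDerivWithinAt_iff_isLittleO]
  have h4 : (fun x => (D⁻¹ * (wedge (ρ x) (σ x - σ t) - (x - t) * wedge (ρ t) σ')) • τ)
      =o[𝓝[s] t] fun x => x - t := by
    refine IsBigO.trans_isLittleO (IsBigO.of_bound (‖D⁻¹‖ * ‖τ‖)
      (Eventually.of_forall fun x => ?_)) hb
    rw [norm_smul, norm_mul]
    exact le_of_eq (by ring)
  refine ((h1.trans_isBigO h3).add h4).congr_left fun x => ?_
  simp only [div_eq_inv_mul, mul_sub, sub_smul, smul_smul]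
  rw [show D⁻¹ * ((x - t) * wedge (ρ t) σ') = (x - t) * (D⁻¹ * wedge (ρ t) σ') by ring]
  abel

/-- A boundary curve `ρ` with `wedge σ ρ` constant inherits regularity from `σ`. -/
lemma regular_of_wedge_const (hK : IsCSCD K) (hN : NoCorners K)
    (hT : ∀ p ∈ frontier K, IsTangent K p (T p)) {σ ρ : ℝ → ℝ × ℝ} {s : Set ℝ}
    (hs : UniqueDiffOn ℝ s) (hσ : ContDiffOn ℝ 1 σ s) (hσf : ∀ t ∈ s, σ t ∈ frontier K)
    (hccw : ∀ t ∈ s, 0 < wedge (σ t) (derivWithin σ s t))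
    (hρ : ContinuousOn ρ s) (hf : ∀ t ∈ s, ρ t ∈ frontier K)
    (hc : ∀ t ∈ s, wedge (σ t) (ρ t) = κ)
    (h1 : ∀ t ∈ s, wedge (σ t) (T (ρ t)) < 0) (h2 : ∀ t ∈ s, wedge (ρ t) (T (σ t)) < 0) :
    ContDiffOn ℝ 1 ρ s ∧ (∀ t ∈ s, derivWithin ρ s t ≠ 0) ∧ (∀ t ∈ s, ρ t ∈ frontier K) ∧
      ∀ t ∈ s, 0 < wedge (ρ t) (derivWithin ρ s t) := by
  obtain ⟨hσd, hσc⟩ := (contDiffOn_one_iff_derivWithin hs).1 hσ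
  have hder : ∀ t ∈ s, HasDerivWithinAt ρ
      ((wedge (ρ t) (derivWithin σ s t) / wedge (σ t) (T (ρ t))) • T (ρ t)) s t := fun t ht =>
    hasDerivWithinAt_of_wedge_const hK hN hT hρ hf hc ht (h1 t ht).ne (hσd t ht).hasDerivWithinAt
  have hderiv : ∀ t ∈ s, derivWithin ρ s t =
      (wedge (ρ t) (derivWithin σ s t) / wedge (σ t) (T (ρ t))) • T (ρ t) := fun t ht =>
    (hder t ht).derivWithin (hs t ht)
  have hpos : ∀ t ∈ s, 0 < wedge (ρ t) (derivWithin ρ s t) := by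
    intro t ht
    rw [hderiv t ht, wedge_smul_right, (hT _ (hf t ht)).1, mul_one]
    refine div_pos_of_neg_of_neg ?_ (h1 t ht)
    have e1 := wedge_deriv_tangent_eq_zero hK hN hT hσ.continuousOn hσf ht (hs t ht)
      (hσd t ht).hasDerivWithinAt
    have e2 := wedge_smul_eq (σ t) (T (σ t)) (derivWithin σ s t)
    rw [e1, (hT _ (hσf t ht)).1, zero_smul, zero_add, one_smul] at e2
    rw [e2, wedge_smul_right]
    exact mul_neg_of_pos_of_neg (hccw t ht) (h2 t ht)
  have hTρ : ContinuousOn (fun x => T (ρ x)) s := (continuousOn_tangent hK hN hT).comp hρ hf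
  refine ⟨(contDiffOn_one_iff_derivWithin hs).2
    ⟨fun t ht => (hder t ht).differentiableWithinAt, ?_⟩, fun t ht h0 => ?_, hf, hpos⟩
  · refine ContinuousOn.congr (ContinuousOn.smul (ContinuousOn.div ?_ ?_ fun t ht => (h1 t ht).ne)
      hTρ) hderiv
    · exact fun t ht => tendsto_wedge (hρ t ht) (hσc t ht)
    · exact fun t ht => tendsto_wedge (hσ.continuousOn t ht) (hTρ t ht)
  · have := hpos t ht
    rw [h0, wedge_zero_right] at this
    exact lt_irrefl _ this

end Regularity

/-- Let `K` be a hexameral domain and `σ 0` a C¹ regular counterclockwise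
parametrization of an arc of its boundary.  For each `t`, let `σ j t`
(`j ∈ ℤ/6ℤ`) be the midpoints, in counterclockwise cyclic order starting from
`σ 0 t`, of the unique balanced hexagon of `K` with `σ 0 t` as a midpoint.
Then `σ 2` and `σ 4` are C¹ regular parametrizations of arcs of the boundary
of `K`, oriented counterclockwise like `σ 0`. -/
theorem sigma2_sigma4_C1 (K : Set (ℝ × ℝ)) (hK : IsHexameral K)
    (t₀ t₁ : ℝ) (ht : t₀ < t₁) (σ : ZMod 6 → ℝ → ℝ × ℝ)
    (hmid : ∀ t ∈ Set.Icc t₀ t₁, ∃ w : ZMod 6 → ℝ × ℝ, IsBalancedHexagon K w ∧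
      ∀ j, σ j t = midpoint ℝ (w j) (w (j + 1)))
    (hC1 : ContDiffOn ℝ 1 (σ 0) (Set.Icc t₀ t₁))
    (hreg : ∀ t ∈ Set.Icc t₀ t₁, derivWithin (σ 0) (Set.Icc t₀ t₁) t ≠ 0)
    (hbd : ∀ t ∈ Set.Icc t₀ t₁, σ 0 t ∈ frontier K)
    (hccw : ∀ t ∈ Set.Icc t₀ t₁, 0 < wedge (σ 0 t) (derivWithin (σ 0) (Set.Icc t₀ t₁) t)) :
    ∀ j ∈ ({2, 4} : Set (ZMod 6)),
      ContDiffOn ℝ 1 (σ j) (Set.Icc t₀ t₁) ∧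
      (∀ t ∈ Set.Icc t₀ t₁, derivWithin (σ j) (Set.Icc t₀ t₁) t ≠ 0) ∧
      (∀ t ∈ Set.Icc t₀ t₁, σ j t ∈ frontier K) ∧
      (∀ t ∈ Set.Icc t₀ t₁, 0 < wedge (σ j t) (derivWithin (σ j) (Set.Icc t₀ t₁) t)) := by
  have hP : ∀ t ∈ Set.Icc t₀ t₁, σ 4 t = -σ 0 t - σ 2 t := by
    intro t ht
    obtain ⟨w, hw, hσ⟩ := hmid t ht
    rw [hσ, hσ, hσ]
    exact hw.midpoint_relation.1
  obtain ⟨κ, hhex, hp⟩ := hK.exists_triple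
  obtain ⟨hC, hN, -, -⟩ := hK
  have hκ : 0 < κ := by
    obtain ⟨w, hw, -⟩ := hmid t₀ (Set.left_mem_Icc.2 ht.le)
    exact (hhex w hw).1
  have htri : ∀ t ∈ Set.Icc t₀ t₁, IsTriple K κ (σ 0 t) (σ 2 t) := by
    intro t ht
    obtain ⟨w, hw, hσ⟩ := hmid t ht
    rw [hσ, hσ]
    exact (hhex w hw).2
  have htri' : ∀ t ∈ Set.Icc t₀ t₁, IsTriple K κ (σ 4 t) (σ 0 t) := by
    intro t ht
    have := ((htri t ht).rotate hC).rotate hC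
    convert this using 1
    · rw [hP t ht]; abel
    · abel
  have hT : ∀ p, ∃ τ, p ∈ frontier K → IsTangent K p τ := by
    intro p
    by_cases hpf : p ∈ frontier K
    · obtain ⟨τ, hτ⟩ := exists_isTangent hC hN hpf
      exact ⟨τ, fun _ => hτ⟩
    · exact ⟨0, fun h => absurd h hpf⟩
  choose T hT using hT
  have hs := uniqueDiffOn_Icc ht
  have hc2 : ContinuousOn (σ 2) (Set.Icc t₀ t₁) :=
    continuousOn_of_isTriple hC hN hκ hp hC1.continuousOn htri
  have hc4 : ContinuousOn (σ 4) (Set.Icc t₀ t₁) :=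
    (hC1.continuousOn.neg.sub hc2).congr hP
  intro j hj
  rcases hj with rfl | rfl
  · exact regular_of_wedge_const hC hN hT hs hC1 hbd hccw hc2
      (fun t ht => (htri t ht).right) (fun t ht => (htri t ht).wedge_eq)
      (fun t ht => (htri t ht).wedge_tangent_neg hC hN hκ hp (hT _ (htri t ht).right))
      (fun t ht => (htri t ht).wedge_tangent_neg' hC hN hκ hp (hT _ (htri t ht).left))
  · exact regular_of_wedge_const (κ := -κ) hC hN hT hs hC1 hbd hccw hc4
      (fun t ht => (htri' t ht).left)
      (fun t ht => by rw [wedge_swap, (htri' t ht).wedge_eq])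
      (fun t ht => (htri' t ht).wedge_tangent_neg' hC hN hκ hp (hT _ (htri' t ht).left))
      (fun t ht => (htri' t ht).wedge_tangent_neg hC hN hκ hp (hT _ (htri' t ht).right))
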